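/- arXiv:1110.3496 — 2 statements merged into one kernel-verified Lean document; each statement's English description precedes it below -/
import Mathlib

section
/- Let k ≥ 2, s > 2k and C ≥ 2. There exists a continuous function J_{k,s}: Λ_k^{(s)} → (0,∞) such that the central-interval contribution ℐ(𝔠enter) = ∫_{|α| ≤ P^{1/3−k}} f(λ_1 α) f(λ_2 α) ⋯ f(λ_s α) d_η α satisfies ℐ(𝔠enter) = η J_{k,s}(λ) P^{s−k} + O(P^{s−k−1/3}), uniformly for 0 < η ≤ 2 and λ ∈ Λ_k^{(s)}(C), with an implicit constant depending only on k, s, C. -/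
open MeasureTheory

/-- e(t) = e^{2πit}. -/
noncomputable def eF (t : ℝ) : ℂ := Complex.exp (2 * Real.pi * Complex.I * t)

/-- The Weyl sum f(α) = Σ_{x ∈ ℤ, |x| ≤ P} e(α x^k). -/
noncomputable def fW (k : ℕ) (P α : ℝ) : ℂ :=
  ∑ x ∈ Finset.Icc (-(⌊P⌋ : ℤ)) ⌊P⌋, eF (α * (x : ℝ) ^ k)

/-- The measure d_η α = η (sin(πηα)/(πηα))² dα on ℝ. -/
noncomputable def dEta (η : ℝ) : Measure ℝ :=
  volume.withDensity fun α =>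
    ENNReal.ofReal (η * (Real.sin (Real.pi * η * α) / (Real.pi * η * α)) ^ 2)

/-- Λ_k^{(s)}: s-tuples of nonzero reals; for even k additionally some λ_i λ_j < 0. -/
def Lam (k s : ℕ) : Set (Fin s → ℝ) :=
  {l | (∀ j, l j ≠ 0) ∧ (Even k → ∃ i j, l i * l j < 0)}

/-- Λ_k^{(s)}(C) = {λ ∈ Λ_k^{(s)} : 1/C ≤ |λ_j| ≤ C}. -/
def LamC (k s : ℕ) (C : ℝ) : Set (Fin s → ℝ) :=
  {l | l ∈ Lam k s ∧ ∀ j, 1 / C ≤ |l j| ∧ |l j| ≤ C}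

namespace CentralInterval

open Set Filter Topology

/-! ### The additive character -/

lemma eF_eq (t : ℝ) : eF t = Complex.exp (Complex.I * ((2 * Real.pi * t : ℝ) : ℂ)) := by
  unfold eF
  congr 1
  push_cast
  ring

@[simp] lemma norm_eF (t : ℝ) : ‖eF t‖ = 1 := by
  rw [eF_eq, Complex.norm_exp_I_mul_ofReal]

lemma eF_add (s t : ℝ) : eF (s + t) = eF s * eF t := by
  rw [eF, eF, eF, ← Complex.exp_add]
  push_cast
  ring_nf

lemma eF_sum {ι : Type*} (S : Finset ι) (g : ι → ℝ) : eF (∑ i ∈ S, g i) = ∏ i ∈ S, eF (g i) := by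
  simp only [eF]
  rw [← Complex.exp_sum, Complex.ofReal_sum, Finset.mul_sum]

lemma conj_eF (t : ℝ) : (starRingEnd ℂ) (eF t) = eF (-t) := by
  rw [eF_eq, eF_eq, ← Complex.exp_conj, map_mul, Complex.conj_I, Complex.conj_ofReal]
  push_cast
  ring_nf

@[fun_prop] lemma continuous_eF : Continuous eF := by
  unfold eF
  fun_prop

lemma norm_eF_sub_eF_le (s t : ℝ) : ‖eF s - eF t‖ ≤ 2 * Real.pi * |s - t| := by
  have h : eF s - eF t = eF t * (eF (s - t) - 1) := by
    rw [mul_sub, ← eF_add, mul_one, add_sub_cancel]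
  rw [h, norm_mul, norm_eF, one_mul, eF_eq]
  refine Real.norm_exp_I_mul_ofReal_sub_one_le.trans_eq ?_
  rw [Real.norm_eq_abs, abs_mul, abs_of_pos Real.two_pi_pos]

lemma hasDerivAt_eF_mul_pow (m : ℕ) (β x : ℝ) :
    HasDerivAt (fun x : ℝ => eF (β * x ^ (m + 1)))
      (eF (β * x ^ (m + 1)) * (2 * Real.pi * Complex.I * β * (m + 1) * x ^ m)) x := by
  have h1 : HasDerivAt (fun x : ℝ => (2 * Real.pi * Complex.I * ((β * x ^ (m + 1) : ℝ) : ℂ)))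
      (2 * Real.pi * Complex.I * ((β * ((m + 1 : ℕ) * x ^ m) : ℝ) : ℂ)) x := by
    have := ((hasDerivAt_pow (m + 1) x).const_mul β).ofReal_comp
    exact this.const_mul _
  refine h1.cexp.congr_deriv ?_
  rw [eF]
  push_cast
  ring

/-! ### The generating integral over the unit interval -/

/-- The integral `∫_{-1}^{1} e(β x^k) dx`. -/
noncomputable def v1 (k : ℕ) (β : ℝ) : ℂ := ∫ x in (-1 : ℝ)..1, eF (β * x ^ k)

@[fun_prop] lemma continuous_v1 (k : ℕ) : Continuous (v1 k) := by
  unfold v1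
  apply intervalIntegral.continuous_parametric_intervalIntegral_of_continuous'
  fun_prop

lemma conj_v1 (k : ℕ) (β : ℝ) : (starRingEnd ℂ) (v1 k β) = v1 k (-β) := by
  simp only [v1]
  rw [intervalIntegral.integral_of_le (by norm_num), intervalIntegral.integral_of_le (by norm_num),
    ← integral_conj]
  simp only [conj_eF, neg_mul]

lemma norm_v1_le_two (k : ℕ) (β : ℝ) : ‖v1 k β‖ ≤ 2 := by
  have := intervalIntegral.norm_integral_le_of_norm_le_const (a := -1) (b := 1) (C := 1)
    (f := fun x : ℝ => eF (β * x ^ k)) (fun x _ => (norm_eF _).le)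
  norm_num at this
  exact this

lemma norm_integral_eF_le_of_pos (m : ℕ) {β δ : ℝ} (hβ : β ≠ 0) (hδ : 0 < δ) (hδ1 : δ ≤ 1) :
    ‖∫ x in δ..1, eF (β * x ^ (m + 1))‖ ≤ (|β| * δ ^ m)⁻¹ := by
  set D : ℂ := 2 * Real.pi * Complex.I * β * (m + 1) with hD
  have hDn : ‖D‖ = 2 * Real.pi * |β| * (m + 1) := by
    have : ‖(m + 1 : ℂ)‖ = m + 1 := by
      rw [← Nat.cast_succ, Complex.norm_natCast]; push_cast; ring
    simp [hD, this, abs_of_pos Real.pi_pos]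
  have hβ' : 0 < |β| := abs_pos.2 hβ
  have hDpos : 0 < ‖D‖ := by rw [hDn]; have := Real.pi_pos; positivity
  have hD0 : D ≠ 0 := norm_pos_iff.1 hDpos
  have hpos : ∀ x ∈ uIcc δ 1, 0 < x := fun x hx => by
    rw [uIcc_of_le hδ1] at hx; exact hδ.trans_le hx.1
  have hF : ∀ x ∈ uIcc δ 1, HasDerivAt (fun x : ℝ => eF (β * x ^ (m + 1)) * (D * (x : ℂ) ^ m)⁻¹)
      (eF (β * x ^ (m + 1)) - eF (β * x ^ (m + 1)) *
        (D * (m * (x : ℂ) ^ (m - 1)) / (D * (x : ℂ) ^ m) ^ 2)) x := by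
    intro x hx
    have hx0 : (x : ℂ) ≠ 0 := by exact_mod_cast (hpos x hx).ne'
    have h2 : HasDerivAt (fun x : ℝ => (D * (x : ℂ) ^ m)) (D * (m * (x : ℂ) ^ (m - 1))) x := by
      have := ((hasDerivAt_pow m (x : ℂ)).const_mul D).comp_ofReal
      simpa using this
    have h3 := h2.fun_inv (by simp [hD0, hx0])
    refine ((hasDerivAt_eF_mul_pow m β x).fun_mul h3).congr_deriv ?_
    rw [← hD]
    have : D * (x : ℂ) ^ m ≠ 0 := by simp [hD0, hx0]
    field_simp
    ring
  have hG : ∀ x ∈ uIcc δ 1, HasDerivAt (fun x : ℝ => -(‖D‖ * x ^ m)⁻¹)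
      (‖D‖ * (m * x ^ (m - 1)) / (‖D‖ * x ^ m) ^ 2) x := by
    intro x hx
    have hx0 := hpos x hx
    refine (((hasDerivAt_pow m x).const_mul ‖D‖).fun_inv (by positivity)).fun_neg.congr_deriv ?_
    ring
  have hGc : ContinuousOn (fun x : ℝ => ‖D‖ * (m * x ^ (m - 1)) / (‖D‖ * x ^ m) ^ 2)
      (uIcc δ 1) := by
    refine ContinuousOn.div (by fun_prop) (by fun_prop) fun x hx => ?_
    have := hpos x hx
    positivity
  have hEc : ContinuousOn (fun x : ℝ => eF (β * x ^ (m + 1)) *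
        (D * (m * (x : ℂ) ^ (m - 1)) / (D * (x : ℂ) ^ m) ^ 2)) (uIcc δ 1) := by
    refine ContinuousOn.mul (by fun_prop) (ContinuousOn.div (by fun_prop) (by fun_prop) ?_)
    intro x hx
    have hx0 : (x : ℂ) ≠ 0 := by exact_mod_cast (hpos x hx).ne'
    simp [hD0, hx0]
  have hec : Continuous fun x : ℝ => eF (β * x ^ (m + 1)) := by fun_prop
  have hFint := intervalIntegral.integral_eq_sub_of_hasDerivAt hF
    ((hec.intervalIntegrable _ _).sub hEc.intervalIntegrable)
  have hGint := intervalIntegral.integral_eq_sub_of_hasDerivAt hG hGc.intervalIntegrable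
  rw [intervalIntegral.integral_sub (hec.intervalIntegrable _ _) hEc.intervalIntegrable,
    sub_eq_iff_eq_add] at hFint
  have hbound := intervalIntegral.norm_integral_le_of_norm_le hδ1 (μ := volume)
    (f := fun x : ℝ => eF (β * x ^ (m + 1)) *
        (D * (m * (x : ℂ) ^ (m - 1)) / (D * (x : ℂ) ^ m) ^ 2))
    (g := fun x : ℝ => ‖D‖ * (m * x ^ (m - 1)) / (‖D‖ * x ^ m) ^ 2)
    (ae_of_all _ fun x hx => by
      have hx0 : 0 < x := hδ.trans hx.1
      simp [abs_of_pos hx0]) hGc.intervalIntegrable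
  rw [hGint] at hbound
  rw [hFint]
  have e1 : ‖eF (β * 1 ^ (m + 1)) * (D * ((1 : ℝ) : ℂ) ^ m)⁻¹‖ = ‖D‖⁻¹ := by simp
  have e2 : ‖eF (β * δ ^ (m + 1)) * (D * (δ : ℂ) ^ m)⁻¹‖ = (‖D‖ * δ ^ m)⁻¹ := by
    simp [abs_of_pos hδ]
  have h3 : 2 * (‖D‖ * δ ^ m)⁻¹ ≤ (|β| * δ ^ m)⁻¹ := by
    rw [hDn, ← div_eq_mul_inv, ← one_div, div_le_div_iff₀ (by have := Real.pi_pos; positivity)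
      (by positivity)]
    have : (1 : ℝ) * 1 ≤ Real.pi * (m + 1) :=
      mul_le_mul (by linarith [Real.pi_gt_three]) (by simp) (by norm_num) Real.pi_pos.le
    nlinarith [mul_pos hβ' (pow_pos hδ m)]
  calc _ ≤ ‖D‖⁻¹ + (‖D‖ * δ ^ m)⁻¹ + (-(‖D‖ * 1 ^ m)⁻¹ - -(‖D‖ * δ ^ m)⁻¹) := by
        refine (norm_add_le _ _).trans (add_le_add ((norm_sub_le _ _).trans ?_) hbound)
        rw [e1, e2]
    _ = 2 * (‖D‖ * δ ^ m)⁻¹ := by simp; ring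
    _ ≤ _ := h3

lemma norm_integral_eF_unit_le (m : ℕ) {β δ : ℝ} (hδ : 0 < δ) (hδ1 : δ ≤ 1)
    (hβδ : |β| * δ ^ (m + 1) = 1) :
    ‖∫ x in (0 : ℝ)..1, eF (β * x ^ (m + 1))‖ ≤ 2 * δ := by
  have hβ : β ≠ 0 := by rintro rfl; simp at hβδ
  have hec : Continuous fun x : ℝ => eF (β * x ^ (m + 1)) := by fun_prop
  rw [← intervalIntegral.integral_add_adjacent_intervals (hec.intervalIntegrable 0 δ)
    (hec.intervalIntegrable δ 1)]
  have h1 : ‖∫ x in (0 : ℝ)..δ, eF (β * x ^ (m + 1))‖ ≤ 1 * |δ - 0| :=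
    intervalIntegral.norm_integral_le_of_norm_le_const fun x _ => (norm_eF _).le
  rw [sub_zero, abs_of_pos hδ, one_mul] at h1
  have h2 := norm_integral_eF_le_of_pos m hβ hδ hδ1
  have h3 : (|β| * δ ^ m)⁻¹ = δ := by
    refine inv_eq_of_mul_eq_one_right ?_
    rw [mul_assoc, ← pow_succ, hβδ]
  rw [h3] at h2
  linarith [norm_add_le (∫ x in (0 : ℝ)..δ, eF (β * x ^ (m + 1)))
    (∫ x in δ..1, eF (β * x ^ (m + 1)))]

lemma norm_v1_le_of_one_le {k : ℕ} (hk : 1 ≤ k) {β : ℝ} (hβ : 1 ≤ |β|) :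
    ‖v1 k β‖ ≤ 4 * |β| ^ (-(1 / k : ℝ)) := by
  obtain ⟨m, rfl⟩ : ∃ m, k = m + 1 := ⟨k - 1, by omega⟩
  set δ : ℝ := |β| ^ (-(1 / (m + 1 : ℕ) : ℝ)) with hδ
  have hβ0 : 0 < |β| := by linarith
  have hδ0 : 0 < δ := Real.rpow_pos_of_pos hβ0 _
  have hδ1 : δ ≤ 1 := Real.rpow_le_one_of_one_le_of_nonpos hβ (by
    rw [neg_nonpos]; positivity)
  have hβδ : |β| * δ ^ (m + 1) = 1 := by
    rw [hδ, ← Real.rpow_natCast, ← Real.rpow_mul hβ0.le, neg_mul, one_div,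
      inv_mul_cancel₀ (by positivity), Real.rpow_neg_one, mul_inv_cancel₀ hβ0.ne']
  have hec : Continuous fun x : ℝ => eF (β * x ^ (m + 1)) := by fun_prop
  rw [v1, ← intervalIntegral.integral_add_adjacent_intervals (hec.intervalIntegrable (-1) 0)
    (hec.intervalIntegrable 0 1)]
  have h1 : (∫ x in (-1 : ℝ)..0, eF (β * x ^ (m + 1)))
      = ∫ x in (0 : ℝ)..1, eF ((β * (-1) ^ (m + 1)) * x ^ (m + 1)) := by
    have := intervalIntegral.integral_comp_neg (a := 0) (b := 1)
      (fun x : ℝ => eF (β * x ^ (m + 1)))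
    rw [neg_zero] at this
    rw [← this]
    refine intervalIntegral.integral_congr fun x _ => ?_
    rw [neg_pow x, mul_assoc]
  rw [h1]
  have h2 := norm_integral_eF_unit_le m hδ0 hδ1 hβδ
  have h3 := norm_integral_eF_unit_le m (β := β * (-1) ^ (m + 1)) hδ0 hδ1
    (by rw [abs_mul, abs_pow]; simpa using hβδ)
  refine (norm_add_le _ _).trans ?_
  linarith

lemma norm_v1_le {k : ℕ} (hk : 1 ≤ k) (β : ℝ) :
    ‖v1 k β‖ ≤ 8 * (1 + |β|) ^ (-(1 / k : ℝ)) := by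
  have hk1 : (1 / k : ℝ) ≤ 1 := by
    rw [div_le_one (by positivity)]; exact_mod_cast hk
  have hk0 : (0 : ℝ) ≤ 1 / k := by positivity
  have key : ∀ M : ℝ, 1 ≤ M → 1 + |β| ≤ 2 * M →
      M ^ (-(1 / k : ℝ)) ≤ 2 * (1 + |β|) ^ (-(1 / k : ℝ)) := by
    intro M hM h
    have hM0 : 0 < M := by linarith
    have h1 : (2 * M) ^ (-(1 / k : ℝ)) ≤ (1 + |β|) ^ (-(1 / k : ℝ)) :=
      Real.rpow_le_rpow_of_nonpos (by positivity) h (by linarith)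
    rw [Real.mul_rpow (by norm_num) hM0.le] at h1
    have h2 : (2 : ℝ)⁻¹ ≤ 2 ^ (-(1 / k : ℝ)) := by
      rw [← Real.rpow_neg_one]
      exact Real.rpow_le_rpow_of_exponent_le (by norm_num) (by linarith)
    have h3 : 0 < M ^ (-(1 / k : ℝ)) := Real.rpow_pos_of_pos hM0 _
    nlinarith
  rcases le_total 1 |β| with h | h
  · have := norm_v1_le_of_one_le hk h
    have := key |β| h (by linarith)
    linarith
  · have := norm_v1_le_two k β
    have := key 1 le_rfl (by linarith)
    rw [Real.one_rpow] at this
    linarith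

lemma norm_v1_mul_le {k : ℕ} (hk : 1 ≤ k) {C : ℝ} (hC : 1 ≤ C) {l : ℝ} (hl : 1 / C ≤ |l|)
    (β : ℝ) : ‖v1 k (l * β)‖ ≤ 8 * C * (1 + |β|) ^ (-(1 / k : ℝ)) := by
  have hk1 : (1 / k : ℝ) ≤ 1 := by
    rw [div_le_one (by positivity)]; exact_mod_cast hk
  have hk0 : (0 : ℝ) ≤ 1 / k := by positivity
  have hC0 : 0 < C := by linarith
  refine (norm_v1_le hk _).trans ?_
  rw [mul_assoc]
  refine mul_le_mul_of_nonneg_left ?_ (by norm_num)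
  have h0 : C⁻¹ * (1 + |β|) ≤ 1 + |l * β| := by
    rw [abs_mul, mul_add, mul_one]
    rw [one_div] at hl
    exact add_le_add (inv_le_one_of_one_le₀ hC) (mul_le_mul_of_nonneg_right hl (abs_nonneg _))
  have h1 := Real.rpow_le_rpow_of_nonpos (by positivity) h0 (neg_nonpos.2 hk0)
  refine h1.trans ?_
  rw [Real.mul_rpow (by positivity) (by positivity)]
  refine mul_le_mul_of_nonneg_right ?_ (by positivity)
  rw [Real.inv_rpow hC0.le, ← Real.rpow_neg hC0.le, neg_neg]
  exact (Real.rpow_le_rpow_of_exponent_le hC hk1).trans_eq (Real.rpow_one C)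

/-! ### The singular integral -/

lemma norm_prod_v1_le {k s : ℕ} (hk : 1 ≤ k) (hs : 2 * k < s) {C : ℝ} (hC : 1 ≤ C)
    {l : Fin s → ℝ} (hl : ∀ j, 1 / C ≤ |l j|) (β : ℝ) :
    ‖∏ j, v1 k (l j * β)‖ ≤ (8 * C) ^ s * ((1 + |β|)⁻¹ * (1 + ‖β‖) ^ (-(1 + 1 / k : ℝ))) := by
  have hβ : (1 : ℝ) ≤ 1 + |β| := by linarith [abs_nonneg β]
  have hβ0 : (0 : ℝ) < 1 + |β| := by linarith
  rw [norm_prod]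
  calc ∏ j, ‖v1 k (l j * β)‖ ≤ ∏ _j : Fin s, (8 * C * (1 + |β|) ^ (-(1 / k : ℝ))) :=
        Finset.prod_le_prod (fun _ _ => norm_nonneg _) fun j _ => norm_v1_mul_le hk hC (hl j) β
    _ = (8 * C) ^ s * (1 + |β|) ^ (-(1 / k : ℝ) * s) := by
        rw [Finset.prod_const, Finset.card_univ, Fintype.card_fin, mul_pow,
          Real.rpow_mul hβ0.le, Real.rpow_natCast]
    _ ≤ (8 * C) ^ s * (1 + |β|) ^ (-1 + -(1 + 1 / k : ℝ)) := by
        refine mul_le_mul_of_nonneg_left (Real.rpow_le_rpow_of_exponent_le hβ ?_) (by positivity)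
        have hk0 : (0 : ℝ) < k := by exact_mod_cast hk
        have hs' : (2 * k + 1 : ℝ) ≤ s := by exact_mod_cast hs
        have : (2 * k + 1 : ℝ) / k ≤ s / k := by gcongr
        have h2 : (2 * k + 1 : ℝ) / k = 2 + 1 / k := by field_simp
        have h3 : -(1 / k : ℝ) * s = -(s / k) := by ring
        linarith
    _ = _ := by rw [Real.rpow_add hβ0, Real.rpow_neg_one, Real.norm_eq_abs]

lemma integrable_majorant {k : ℕ} (hk : 1 ≤ k) :
    Integrable fun β : ℝ => (1 + ‖β‖) ^ (-(1 + 1 / k : ℝ)) := by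
  refine integrable_one_add_norm ?_
  have : (0 : ℝ) < 1 / k := by positivity
  simpa using this

lemma norm_prod_v1_le' {k s : ℕ} (hk : 1 ≤ k) (hs : 2 * k < s) {C : ℝ} (hC : 1 ≤ C)
    {l : Fin s → ℝ} (hl : ∀ j, 1 / C ≤ |l j|) (β : ℝ) :
    ‖∏ j, v1 k (l j * β)‖ ≤ (8 * C) ^ s * (1 + ‖β‖) ^ (-(1 + 1 / k : ℝ)) := by
  refine (norm_prod_v1_le hk hs hC hl β).trans ?_
  refine mul_le_mul_of_nonneg_left ?_ (by positivity)
  refine mul_le_of_le_one_left (by positivity) (inv_le_one_of_one_le₀ ?_)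
  linarith [abs_nonneg β]

lemma integrable_prod_v1 {k s : ℕ} (hk : 1 ≤ k) (hs : 2 * k < s) {C : ℝ} (hC : 1 ≤ C)
    {l : Fin s → ℝ} (hl : ∀ j, 1 / C ≤ |l j|) :
    Integrable fun β : ℝ => ∏ j, v1 k (l j * β) := by
  refine Integrable.mono' ((integrable_majorant hk).const_mul ((8 * C) ^ s)) ?_
    (ae_of_all _ (norm_prod_v1_le' hk hs hC hl))
  exact Continuous.aestronglyMeasurable (by fun_prop)

lemma exists_lower_bound {s : ℕ} {l : Fin s → ℝ} (hl : ∀ j, l j ≠ 0) :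
    ∃ C : ℝ, 1 ≤ C ∧ ∀ j, 1 / C < |l j| := by
  refine ⟨1 + ∑ j, |l j|⁻¹, ?_, fun j => ?_⟩
  · have : 0 ≤ ∑ j, |l j|⁻¹ := Finset.sum_nonneg fun _ _ => by positivity
    linarith
  · have h1 : |l j|⁻¹ ≤ ∑ j, |l j|⁻¹ :=
      Finset.single_le_sum (f := fun j => |l j|⁻¹) (fun _ _ => by positivity) (Finset.mem_univ j)
    have h2 : 0 < |l j| := abs_pos.2 (hl j)
    rw [one_div]
    exact inv_lt_of_inv_lt₀ h2 (by linarith)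

/-- The singular integral `∫ ∏ v_1(λ_j β) dβ`. -/
noncomputable def singularIntegral (k s : ℕ) (l : Fin s → ℝ) : ℂ :=
  ∫ β : ℝ, ∏ j, v1 k (l j * β)

lemma continuousAt_singularIntegral {k s : ℕ} (hk : 1 ≤ k) (hs : 2 * k < s)
    {l : Fin s → ℝ} (hl : ∀ j, l j ≠ 0) : ContinuousAt (singularIntegral k s) l := by
  obtain ⟨C, hC, hlC⟩ := exists_lower_bound hl
  have hnear : ∀ᶠ l' : Fin s → ℝ in 𝓝 l, ∀ j, 1 / C < |l' j| :=
    eventually_all.2 fun j =>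
      (by fun_prop : Continuous fun l' : Fin s → ℝ => |l' j|).continuousAt.eventually_const_lt
        (hlC j)
  refine continuousAt_of_dominated
    (bound := fun β : ℝ => (8 * C) ^ s * (1 + ‖β‖) ^ (-(1 + 1 / k : ℝ))) ?_ ?_
    ((integrable_majorant hk).const_mul _) ?_
  · exact Eventually.of_forall fun l' => Continuous.aestronglyMeasurable (by fun_prop)
  · filter_upwards [hnear] with l' hl'
    exact ae_of_all _ (norm_prod_v1_le' hk hs hC fun j => (hl' j).le)
  · exact ae_of_all _ fun β => Continuous.continuousAt (by fun_prop)

lemma ofReal_re_singularIntegral (k s : ℕ) (l : Fin s → ℝ) :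
    ((singularIntegral k s l).re : ℂ) = singularIntegral k s l := by
  rw [← Complex.conj_eq_iff_re, singularIntegral, ← integral_conj,
    ← integral_neg_eq_self (fun β : ℝ => ∏ j, v1 k (l j * β)) volume]
  simp only [map_prod, conj_v1, mul_neg]

lemma integral_eF_mul_gaussian {b : ℝ} (hb : 0 < b) (t : ℝ) :
    ∫ β : ℝ, eF (β * t) * (Real.exp (-(Real.pi * b) * β ^ 2) : ℂ)
      = (((√b)⁻¹ * Real.exp (-(Real.pi * t ^ 2 / b)) : ℝ) : ℂ) := by
  have hπ := Real.pi_pos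
  have h := fourierIntegral_gaussian (b := ((Real.pi * b : ℝ) : ℂ))
    (by rw [Complex.ofReal_re]; positivity) ((2 * Real.pi * t : ℝ) : ℂ)
  have e1 : (Real.pi / ((Real.pi * b : ℝ) : ℂ)) ^ (1 / 2 : ℂ) = (((√b)⁻¹ : ℝ) : ℂ) := by
    have : (Real.pi / ((Real.pi * b : ℝ) : ℂ)) = ((b⁻¹ : ℝ) : ℂ) := by
      push_cast
      have : (Real.pi : ℂ) ≠ 0 := by exact_mod_cast hπ.ne'
      field_simp
    rw [this, ← Real.sqrt_inv, Real.sqrt_eq_rpow, Complex.ofReal_cpow (by positivity)]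
    norm_num
  rw [e1] at h
  convert h using 1
  · refine integral_congr_ae (ae_of_all _ fun β => ?_)
    simp only [eF_eq]
    push_cast
    congr 2
    ring
  · push_cast
    congr 2
    have : (Real.pi : ℂ) ≠ 0 := by exact_mod_cast hπ.ne'
    have : (b : ℂ) ≠ 0 := by exact_mod_cast hb.ne'
    field_simp
    ring

/-- Lebesgue measure on the unit interval `(-1, 1]`. -/
noncomputable abbrev boxMeasure : Measure ℝ := volume.restrict (Ioc (-1) 1)

lemma prod_v1_eq_integral (k s : ℕ) (l : Fin s → ℝ) (β : ℝ) :
    ∏ j, v1 k (l j * β)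
      = ∫ x : Fin s → ℝ, eF (β * ∑ j, l j * x j ^ k) ∂Measure.pi fun _ => boxMeasure := by
  have h : ∀ j, v1 k (l j * β) = ∫ x, eF (l j * β * x ^ k) ∂boxMeasure := fun j =>
    intervalIntegral.integral_of_le (by norm_num)
  simp_rw [h]
  rw [← integral_fintype_prod_eq_prod (fun j x => eF (l j * β * x ^ k))]
  refine integral_congr_ae (ae_of_all _ fun x => ?_)
  simp only
  rw [← eF_sum, Finset.mul_sum]
  congr 1
  exact Finset.sum_congr rfl fun j _ => by ring

lemma integral_prod_v1_mul_gaussian (k s : ℕ) (l : Fin s → ℝ) {b : ℝ} (hb : 0 < b) :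
    ∫ β : ℝ, (∏ j, v1 k (l j * β)) * (Real.exp (-(Real.pi * b) * β ^ 2) : ℂ)
      = ((∫ x : Fin s → ℝ, (√b)⁻¹ * Real.exp (-(Real.pi * (∑ j, l j * x j ^ k) ^ 2 / b))
          ∂Measure.pi fun _ => boxMeasure : ℝ) : ℂ) := by
  rw [← integral_complex_ofReal]
  simp_rw [← integral_eF_mul_gaussian hb, prod_v1_eq_integral]
  rw [integral_integral_swap]
  · refine integral_congr_ae (ae_of_all _ fun β => ?_)
    simp only
    rw [integral_mul_const]
  · have hg : Integrable fun β : ℝ => (Real.exp (-(Real.pi * b) * β ^ 2) : ℂ) :=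
      (integrable_exp_neg_mul_sq (by have := Real.pi_pos; positivity)).ofReal
    refine (hg.comp_snd (Measure.pi fun _ => boxMeasure)).mono
      (Continuous.aestronglyMeasurable (by fun_prop)) (ae_of_all _ fun z => ?_)
    simp [Function.uncurry]

lemma le_integral_gaussian_fibre {k : ℕ} (hk : 1 ≤ k) {a r y b : ℝ} (ha : a ≠ 0) (hy0 : 0 ≤ y)
    (hy1 : y ≤ 1) (hy : a * y ^ k = -r) (hb : 0 < b) (hb1 : (|a| * k)⁻¹ * √b ≤ 1) :
    (|a| * k)⁻¹ * Real.exp (-Real.pi)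
      ≤ ∫ x, (√b)⁻¹ * Real.exp (-(Real.pi * (a * x ^ k + r) ^ 2 / b)) ∂boxMeasure := by
  have hπ := Real.pi_pos
  have ha' : 0 < |a| := abs_pos.2 ha
  have hk' : (0 : ℝ) < k := by exact_mod_cast hk
  have hsb : 0 < √b := Real.sqrt_pos.2 hb
  set w : ℝ := (|a| * k)⁻¹ with hw
  have hw0 : 0 < w := by positivity
  have hwb : 0 < w * √b := by positivity
  set g : ℝ → ℝ := fun x => (√b)⁻¹ * Real.exp (-(Real.pi * (a * x ^ k + r) ^ 2 / b)) with hg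
  have hgc : Continuous g := by fun_prop
  have hsub : Ioc (y - w * √b) y ⊆ Ioc (-1) 1 := Ioc_subset_Ioc (by linarith) hy1
  have hgInt : IntegrableOn g (Ioc (-1) 1) := hgc.integrableOn_Ioc
  have hle : ∀ x ∈ Ioc (y - w * √b) y, (√b)⁻¹ * Real.exp (-Real.pi) ≤ g x := by
    intro x hx
    refine mul_le_mul_of_nonneg_left (Real.exp_le_exp.2 (neg_le_neg ?_)) (by positivity)
    rw [mul_div_assoc]
    refine mul_le_of_le_one_right hπ.le ?_
    rw [div_le_one hb]
    have hx' := hsub hx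
    have h1 : |a * x ^ k + r| ≤ √b := by
      have : a * x ^ k + r = a * (x ^ k - y ^ k) := by rw [mul_sub, hy]; ring
      rw [this, abs_mul]
      have h2 := abs_pow_sub_pow_le x y k
      have h3 : max |x| |y| ^ (k - 1) ≤ 1 :=
        pow_le_one₀ (by positivity)
          (max_le (abs_le.2 ⟨hx'.1.le, hx'.2⟩) (abs_le.2 ⟨by linarith, hy1⟩))
      have h4 : |x - y| ≤ w * √b := abs_le.2 ⟨by linarith [hx.1], by linarith [hx.2]⟩
      calc |a| * |x ^ k - y ^ k| ≤ |a| * (w * √b * k * 1) := by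
            refine mul_le_mul_of_nonneg_left (h2.trans ?_) ha'.le
            gcongr
        _ = √b := by rw [hw]; field_simp
    calc (a * x ^ k + r) ^ 2 = |a * x ^ k + r| ^ 2 := (sq_abs _).symm
      _ ≤ √b ^ 2 := by gcongr
      _ = b := Real.sq_sqrt hb.le
  calc w * Real.exp (-Real.pi)
      = (√b)⁻¹ * Real.exp (-Real.pi) * volume.real (Ioc (y - w * √b) y) := by
        rw [Real.volume_real_Ioc_of_le (by linarith)]
        field_simp
        ring
    _ ≤ ∫ x in Ioc (y - w * √b) y, g x :=
        setIntegral_ge_of_const_le_real measurableSet_Ioc (by simp) hle (hgInt.mono_set hsub)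
    _ ≤ ∫ x in Ioc (-1) 1, g x :=
        setIntegral_mono_set hgInt (ae_of_all _ fun x => by simp only [hg, Pi.zero_apply]; positivity)
          (ae_of_all _ hsub)

lemma real_pi_boxMeasure_pos {n : ℕ} {U : Set (Fin n → ℝ)} (hUo : IsOpen U) (hUne : U.Nonempty)
    (hU : ∀ y ∈ U, ∀ j, |y j| < 1) : 0 < (Measure.pi fun _ : Fin n => boxMeasure).real U := by
  rw [Measure.real, ENNReal.toReal_pos_iff]
  refine ⟨?_, measure_lt_top _ _⟩
  rw [← Measure.restrict_pi_pi (fun _ => volume) (fun _ => Ioc (-1) 1),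
    Measure.restrict_apply hUo.measurableSet, inter_eq_self_of_subset_left, ← volume_pi]
  · exact hUo.measure_pos _ hUne
  · intro y hy j _
    have := abs_lt.1 (hU y hy j)
    exact ⟨this.1, this.2.le⟩

lemma integral_pi_boxMeasure_succ {n : ℕ} (i : Fin (n + 1)) (G : ℝ × (Fin n → ℝ) → ℝ) :
    ∫ x : Fin (n + 1) → ℝ, G (x i, fun j => x (i.succAbove j)) ∂Measure.pi (fun _ => boxMeasure)
      = ∫ z, G z ∂boxMeasure.prod (Measure.pi fun _ => boxMeasure) :=
  (measurePreserving_piFinSuccAbove (fun _ : Fin (n + 1) => boxMeasure) i).integral_comp' G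

lemma le_integral_gaussian_prod {α : Type*} [MeasurableSpace α] (ν : Measure α)
    [IsFiniteMeasure ν] {k : ℕ} (hk : 1 ≤ k) {a : ℝ} (ha : a ≠ 0) {R : α → ℝ} (hR : Measurable R)
    {U : Set α} (hUm : MeasurableSet U) (hU : ∀ y ∈ U, 0 < -R y / a ∧ -R y / a < 1)
    {b : ℝ} (hb : 0 < b) (hb1 : (|a| * k)⁻¹ * √b ≤ 1) :
    (|a| * k)⁻¹ * Real.exp (-Real.pi) * ν.real U
      ≤ ∫ z : ℝ × α, (√b)⁻¹ * Real.exp (-(Real.pi * (a * z.1 ^ k + R z.2) ^ 2 / b))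
          ∂boxMeasure.prod ν := by
  set G : ℝ × α → ℝ := fun z =>
    (√b)⁻¹ * Real.exp (-(Real.pi * (a * z.1 ^ k + R z.2) ^ 2 / b)) with hG
  have hG0 : ∀ z, 0 ≤ G z := fun z =>
    mul_nonneg (inv_nonneg.2 (Real.sqrt_nonneg _)) (Real.exp_pos _).le
  have hGint : Integrable G (boxMeasure.prod ν) := by
    refine Integrable.of_bound (C := (√b)⁻¹)
      (Measurable.aestronglyMeasurable (by fun_prop)) (ae_of_all _ fun z => ?_)
    rw [Real.norm_of_nonneg (hG0 z)]
    refine mul_le_of_le_one_right (by positivity) (Real.exp_le_one_iff.2 (neg_nonpos.2 ?_))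
    have := Real.pi_pos
    positivity
  have hfib : ∀ y ∈ U, (|a| * k)⁻¹ * Real.exp (-Real.pi) ≤ ∫ x, G (x, y) ∂boxMeasure := by
    intro y hy
    have hroot : a * ((-R y / a) ^ ((k : ℝ)⁻¹)) ^ k = -R y := by
      rw [Real.rpow_inv_natCast_pow (hU y hy).1.le (Nat.one_le_iff_ne_zero.1 hk),
        mul_div_cancel₀ _ ha]
    exact le_integral_gaussian_fibre (r := R y) hk ha (Real.rpow_nonneg (hU y hy).1.le _)
      (Real.rpow_le_one (hU y hy).1.le (hU y hy).2.le (inv_nonneg.2 k.cast_nonneg)) hroot hb hb1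
  rw [integral_prod_symm _ hGint]
  exact (setIntegral_ge_of_const_le_real hUm (measure_ne_top _ _) hfib
    hGint.integral_prod_right.integrableOn).trans
    (setIntegral_le_integral hGint.integral_prod_right (ae_of_all _ fun y =>
      integral_nonneg fun x => hG0 _))

lemma exists_le_integral_gaussian_box {k n : ℕ} (hk : 1 ≤ k) {l : Fin (n + 1) → ℝ}
    (i : Fin (n + 1)) (hi : l i ≠ 0) {y₀ : Fin n → ℝ} (hy₀ : ∀ j, |y₀ j| < 1)
    (hpos : 0 < -(∑ j, l (i.succAbove j) * y₀ j ^ k) / l i)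
    (hlt : -(∑ j, l (i.succAbove j) * y₀ j ^ k) / l i < 1) :
    ∃ c : ℝ, 0 < c ∧ ∀ᶠ b : ℝ in 𝓝[>] 0,
      c ≤ ∫ x : Fin (n + 1) → ℝ, (√b)⁻¹ * Real.exp (-(Real.pi * (∑ j, l j * x j ^ k) ^ 2 / b))
          ∂Measure.pi fun _ => boxMeasure := by
  set U : Set (Fin n → ℝ) := {y | (∀ j, |y j| < 1) ∧
    0 < -(∑ j, l (i.succAbove j) * y j ^ k) / l i ∧
    -(∑ j, l (i.succAbove j) * y j ^ k) / l i < 1} with hU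
  have hUo : IsOpen U := by
    have h1 : IsOpen {y : Fin n → ℝ | ∀ j, |y j| < 1} := by
      simp only [ofPred_forall]
      exact isOpen_iInter_of_finite fun j => isOpen_lt (by fun_prop) continuous_const
    have h2 : Continuous fun y : Fin n → ℝ => -(∑ j, l (i.succAbove j) * y j ^ k) / l i := by
      fun_prop
    exact h1.inter ((isOpen_lt continuous_const h2).inter (isOpen_lt h2 continuous_const))
  have hνU := real_pi_boxMeasure_pos hUo ⟨y₀, hy₀, hpos, hlt⟩ fun y hy => hy.1
  have hi' : 0 < (|l i| * k)⁻¹ :=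
    inv_pos.2 (mul_pos (abs_pos.2 hi) (by exact_mod_cast hk))
  refine ⟨(|l i| * k)⁻¹ * Real.exp (-Real.pi) * (Measure.pi fun _ => boxMeasure).real U,
    mul_pos (mul_pos hi' (Real.exp_pos _)) hνU, ?_⟩
  have hsmall : ∀ᶠ b : ℝ in 𝓝[>] 0, (|l i| * k)⁻¹ * √b < 1 := by
    have : Continuous fun b : ℝ => (|l i| * k)⁻¹ * √b := by fun_prop
    exact (this.tendsto 0).eventually_lt_const (by simp) |>.filter_mono nhdsWithin_le_nhds
  filter_upwards [hsmall, self_mem_nhdsWithin] with b hb1 hb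
  refine (le_integral_gaussian_prod (Measure.pi fun _ => boxMeasure) hk hi
    (R := fun y => ∑ j, l (i.succAbove j) * y j ^ k) (by fun_prop) hUo.measurableSet
    (fun y hy => hy.2) hb hb1.le).trans_eq ?_
  rw [← integral_pi_boxMeasure_succ i]
  simp only [Fin.sum_univ_succAbove _ i]

lemma tendsto_integral_prod_v1_mul_gaussian {k s : ℕ} (hk : 1 ≤ k) (hs : 2 * k < s)
    {l : Fin s → ℝ} (hl : ∀ j, l j ≠ 0) :
    Tendsto (fun b : ℝ => ∫ β : ℝ, (∏ j, v1 k (l j * β)) *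
      (Real.exp (-(Real.pi * b) * β ^ 2) : ℂ)) (𝓝[>] 0) (𝓝 (singularIntegral k s l)) := by
  obtain ⟨C, hC, hlC⟩ := exists_lower_bound hl
  refine tendsto_integral_filter_of_dominated_convergence
    (fun β => ‖∏ j, v1 k (l j * β)‖) ?_ ?_
    (integrable_prod_v1 hk hs hC fun j => (hlC j).le).norm ?_
  · exact Eventually.of_forall fun b => Continuous.aestronglyMeasurable (by fun_prop)
  · filter_upwards [self_mem_nhdsWithin] with b hb
    rw [mem_Ioi] at hb
    refine ae_of_all _ fun β => ?_
    rw [norm_mul, Complex.norm_real, Real.norm_of_nonneg (Real.exp_pos _).le]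
    refine mul_le_of_le_one_right (norm_nonneg _) (Real.exp_le_one_iff.2 ?_)
    rw [neg_mul, neg_nonpos]
    have := Real.pi_pos
    positivity
  · refine ae_of_all _ fun β => ?_
    have : Continuous fun b : ℝ => (∏ j, v1 k (l j * β)) *
      (Real.exp (-(Real.pi * b) * β ^ 2) : ℂ) := by fun_prop
    have h := (this.tendsto 0).mono_left (nhdsWithin_le_nhds (s := Ioi 0))
    simpa using h

lemma exists_nonsingular_point {k n : ℕ} (hk : 1 ≤ k) (hn : 1 ≤ n) {l : Fin (n + 1) → ℝ}
    (hl : l ∈ Lam k (n + 1)) :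
    ∃ i, ∃ y : Fin n → ℝ, (∀ j, |y j| < 1) ∧
      0 < -(∑ j, l (i.succAbove j) * y j ^ k) / l i ∧
      -(∑ j, l (i.succAbove j) * y j ^ k) / l i < 1 := by
  obtain ⟨i, j, σ, hσ, hneg⟩ : ∃ i : Fin (n + 1), ∃ j : Fin n, ∃ σ : ℝ, |σ| = 1 ∧
      0 < -(l (i.succAbove j) * σ ^ k) / l i := by
    rcases Nat.even_or_odd k with he | ho
    · obtain ⟨i, i', h⟩ := hl.2 he
      have hne : i' ≠ i := by
        rintro rfl
        exact absurd h (not_lt.2 (mul_self_nonneg _))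
      obtain ⟨j, rfl⟩ := Fin.exists_succAbove_eq hne
      refine ⟨i, j, 1, abs_one, ?_⟩
      rw [one_pow, mul_one, div_eq_mul_inv, ← div_eq_mul_inv]
      rcases mul_neg_iff.1 h with ⟨h1, h2⟩ | ⟨h1, h2⟩
      · exact div_pos (neg_pos.2 h2) h1
      · exact div_pos_of_neg_of_neg (neg_neg_iff_pos.2 h2) h1
    · have hi := hl.1 0
      have hj := hl.1 ((0 : Fin (n + 1)).succAbove ⟨0, hn⟩)
      rcases (div_ne_zero hj hi).lt_or_gt with h | h
      · exact ⟨0, ⟨0, hn⟩, 1, abs_one, by rw [one_pow, mul_one, neg_div]; linarith⟩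
      · refine ⟨0, ⟨0, hn⟩, -1, by simp, ?_⟩
        rw [ho.neg_one_pow, mul_neg_one, neg_neg]
        exact h
  set A := -(l (i.succAbove j) * σ ^ k) / l i with hA
  set t : ℝ := (2 + A)⁻¹ with ht
  have ht0 : 0 < t := by positivity
  have ht1 : t < 1 := inv_lt_one_of_one_lt₀ (by linarith)
  have htA : t * A < 1 := by
    rw [ht, inv_mul_lt_one₀ (by linarith)]
    linarith
  have hsum : -(∑ j', l (i.succAbove j') * (Pi.single j (t * σ) : Fin n → ℝ) j' ^ k) / l i
      = t ^ k * A := by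
    rw [Finset.sum_eq_single j, Pi.single_eq_same, hA, mul_pow]
    · ring
    · intro j' _ hj'
      rw [Pi.single_eq_of_ne hj', zero_pow (by omega), mul_zero]
    · simp
  refine ⟨i, Pi.single j (t * σ), fun j' => ?_, ?_, ?_⟩
  · by_cases h : j' = j
    · subst h
      rw [Pi.single_eq_same, abs_mul, hσ, mul_one, abs_of_pos ht0]
      exact ht1
    · simp [Pi.single_eq_of_ne h]
  · rw [hsum]; positivity
  · rw [hsum]
    have : t ^ k ≤ t := pow_le_of_le_one ht0.le ht1.le (by omega)
    nlinarith

lemma re_singularIntegral_pos {k s : ℕ} (hk : 1 ≤ k) (hs : 2 * k < s) {l : Fin s → ℝ}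
    (hl : l ∈ Lam k s) : 0 < (singularIntegral k s l).re := by
  obtain ⟨n, rfl⟩ : ∃ n, s = n + 1 := ⟨s - 1, by omega⟩
  obtain ⟨i, y, hy, h0, h1⟩ := exists_nonsingular_point hk (by omega) hl
  obtain ⟨c, hc, hev⟩ := exists_le_integral_gaussian_box hk i (hl.1 i) hy h0 h1
  have ht := (Complex.continuous_re.tendsto _).comp
    (tendsto_integral_prod_v1_mul_gaussian hk hs hl.1)
  refine hc.trans_le (ge_of_tendsto ht ?_)
  filter_upwards [hev, self_mem_nhdsWithin] with b hb hb0
  rw [Function.comp_apply, integral_prod_v1_mul_gaussian _ _ _ hb0, Complex.ofReal_re]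
  exact hb

/-! ### Approximating the Weyl sum by the generating integral -/

lemma norm_sub_integral_unit_le {φ : ℝ → ℂ} (hφ : Continuous φ) {L P : ℝ}
    (hL : ∀ x ∈ Icc (-P) P, ∀ y ∈ Icc (-P) P, ‖φ x - φ y‖ ≤ L * |x - y|) (hL0 : 0 ≤ L)
    {a c : ℝ} (ha : -P ≤ a) (hb : a + 1 ≤ P) (hc : c ∈ Icc a (a + 1)) :
    ‖φ c - ∫ x in a..a + 1, φ x‖ ≤ L := by
  have h1 : φ c - ∫ x in a..a + 1, φ x = ∫ x in a..a + 1, (φ c - φ x) := by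
    rw [intervalIntegral.integral_sub intervalIntegrable_const (hφ.intervalIntegrable _ _)]
    simp
  rw [h1]
  have h2 := intervalIntegral.norm_integral_le_of_norm_le_const (a := a) (b := a + 1) (C := L)
    (f := fun x => φ c - φ x) fun x hx => by
      rw [uIoc_of_le (by linarith)] at hx
      refine (hL c ⟨by linarith [hc.1], by linarith [hc.2]⟩ x
        ⟨by linarith [hx.1], by linarith [hx.2]⟩).trans ?_
      refine mul_le_of_le_one_right hL0 (abs_le.2 ⟨?_, ?_⟩)
      · linarith [hc.1, hx.2]
      · linarith [hc.2, hx.1]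
  simpa using h2

lemma norm_sum_sub_integral_le {φ : ℝ → ℂ} (hφ : Continuous φ) (hφ1 : ∀ x, ‖φ x‖ ≤ 1) {L P : ℝ}
    (hL : ∀ x ∈ Icc (-P) P, ∀ y ∈ Icc (-P) P, ‖φ x - φ y‖ ≤ L * |x - y|) (hL0 : 0 ≤ L)
    (N : ℕ) (hN : N ≤ P) :
    ‖∑ x ∈ Finset.Icc (-(N : ℤ)) N, φ x - ∫ x in (-(N : ℝ))..N, φ x‖ ≤ 1 + 2 * N * L := by
  induction N with
  | zero => simpa using hφ1 0
  | succ N ih =>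
    push_cast at hN ⊢
    have ih' := ih (by linarith)
    have hN0 : (0 : ℝ) ≤ N := N.cast_nonneg
    rw [Finset.sum_Icc_succ_eq_add_endpoints (fun x : ℤ => φ x)]
    push_cast
    have hi := fun a b => hφ.intervalIntegrable (μ := volume) a b
    rw [← intervalIntegral.integral_add_adjacent_intervals (hi _ (-N)) (hi _ (N + 1)),
      ← intervalIntegral.integral_add_adjacent_intervals (hi (-N) N) (hi N (N + 1))]
    have h1 := norm_sub_integral_unit_le hφ hL hL0 (a := N) (c := N + 1) (by linarith) hN
      ⟨by linarith, le_rfl⟩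
    have h2 := norm_sub_integral_unit_le hφ hL hL0 (a := -(N + 1)) (c := -(N + 1)) (by linarith)
      (by linarith) ⟨le_rfl, by linarith⟩
    rw [show -(N + 1 : ℝ) + 1 = -N by ring] at h2
    set I1 := ∫ x in (N : ℝ)..(N + 1), φ x
    set I2 := ∫ x in (-(N + 1) : ℝ)..(-N), φ x
    set I3 := ∫ x in (-N : ℝ)..N, φ x
    set T := ∑ x ∈ Finset.Icc (-(N : ℤ)) N, φ x
    have e : φ (N + 1) + φ (-(N + 1)) + T - (I2 + (I3 + I1))
        = (φ (N + 1) - I1) + (φ (-(N + 1)) - I2) + (T - I3) := by ring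
    rw [e]
    calc _ ≤ L + L + (1 + 2 * N * L) := norm_add₃_le.trans (by gcongr)
      _ = _ := by ring

lemma norm_fW_sub_le (k : ℕ) (hk : 1 ≤ k) {P : ℝ} (hP : 0 < P) (α : ℝ) :
    ‖fW k P α - P * v1 k (α * P ^ k)‖ ≤ 3 + 4 * Real.pi * k * (|α| * P ^ k) := by
  have hπ := Real.pi_pos
  set φ : ℝ → ℂ := fun x => eF (α * x ^ k) with hφdef
  have hφ : Continuous φ := by fun_prop
  have hφ1 : ∀ x, ‖φ x‖ ≤ 1 := fun x => (norm_eF _).le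
  set L : ℝ := 2 * Real.pi * |α| * k * P ^ (k - 1) with hLdef
  have hL0 : 0 ≤ L := by positivity
  have hL : ∀ x ∈ Icc (-P) P, ∀ y ∈ Icc (-P) P, ‖φ x - φ y‖ ≤ L * |x - y| := by
    intro x hx y hy
    refine (norm_eF_sub_eF_le _ _).trans ?_
    rw [← mul_sub, abs_mul]
    have h1 := abs_pow_sub_pow_le x y k
    have h2 : max |x| |y| ^ (k - 1) ≤ P ^ (k - 1) :=
      pow_le_pow_left₀ (by positivity) (max_le (abs_le.2 hx) (abs_le.2 hy)) _
    calc 2 * Real.pi * (|α| * |x ^ k - y ^ k|)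
        ≤ 2 * Real.pi * (|α| * (|x - y| * k * P ^ (k - 1))) := by
          gcongr
          exact h1.trans (by gcongr)
      _ = L * |x - y| := by rw [hLdef]; ring
  set N : ℕ := ⌊P⌋.toNat with hNdef
  have hNf : ((N : ℕ) : ℤ) = ⌊P⌋ := Int.toNat_of_nonneg (Int.floor_nonneg.2 hP.le)
  have hNr : (N : ℝ) = (⌊P⌋ : ℝ) := by exact_mod_cast hNf
  have hN : (N : ℝ) ≤ P := hNr ▸ Int.floor_le P
  have hN1 : P < N + 1 := hNr ▸ Int.lt_floor_add_one P
  have hmain := norm_sum_sub_integral_le hφ hφ1 hL hL0 N hN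
  have hv : (P : ℂ) * v1 k (α * P ^ k) = ∫ x in (-P)..P, φ x := by
    have h := intervalIntegral.smul_integral_comp_mul_left (a := -1) (b := 1) φ P
    rw [mul_neg_one, mul_one] at h
    rw [← h, Complex.real_smul, v1]
    congr 1
    refine intervalIntegral.integral_congr fun x _ => ?_
    simp only [hφdef]
    congr 1
    ring
  have hi := fun a b => hφ.intervalIntegrable (μ := volume) a b
  rw [hv, ← intervalIntegral.integral_add_adjacent_intervals (hi (-P) (-N)) (hi _ P),
    ← intervalIntegral.integral_add_adjacent_intervals (hi (-N) N) (hi N P)]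
  have hb1 : ‖∫ x in (-P)..(-N), φ x‖ ≤ 1 := by
    refine (intervalIntegral.norm_integral_le_of_norm_le_const fun x _ => hφ1 x).trans ?_
    rw [one_mul]
    exact abs_le.2 ⟨by linarith, by linarith⟩
  have hb2 : ‖∫ x in (N : ℝ)..P, φ x‖ ≤ 1 := by
    refine (intervalIntegral.norm_integral_le_of_norm_le_const fun x _ => hφ1 x).trans ?_
    rw [one_mul]
    exact abs_le.2 ⟨by linarith, by linarith⟩
  have hf : fW k P α = ∑ x ∈ Finset.Icc (-(N : ℤ)) N, φ x := by rw [fW, hNf]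
  rw [hf]
  set I1 := ∫ x in (N : ℝ)..P, φ x
  set I2 := ∫ x in (-P : ℝ)..(-N), φ x
  set I3 := ∫ x in (-N : ℝ)..N, φ x
  set T := ∑ x ∈ Finset.Icc (-(N : ℤ)) N, φ x
  have hPL : 2 * N * L ≤ 4 * Real.pi * k * (|α| * P ^ k) := by
    calc 2 * N * L ≤ 2 * P * L := by gcongr
      _ = 4 * Real.pi * k * (|α| * (P ^ (k - 1) * P)) := by rw [hLdef]; ring
      _ = _ := by rw [← pow_succ, Nat.sub_add_cancel hk]
  calc ‖T - (I2 + (I3 + I1))‖ = ‖(T - I3) - I2 - I1‖ := by congr 1; ring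
    _ ≤ ‖T - I3‖ + ‖I2‖ + ‖I1‖ := (norm_sub_le _ _).trans (by gcongr; exact norm_sub_le _ _)
    _ ≤ _ := by linarith

lemma norm_prod_sub_prod_le {ι : Type*} (S : Finset ι) {a b : ι → ℂ} {B D : ℝ} (hB : 0 ≤ B)
    (ha : ∀ i, ‖a i‖ ≤ B) (hb : ∀ i, ‖b i‖ ≤ B) (hab : ∀ i, ‖a i - b i‖ ≤ D) :
    ‖∏ i ∈ S, a i - ∏ i ∈ S, b i‖ ≤ S.card * D * B ^ (S.card - 1) := by
  classical
  induction S using Finset.induction_on with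
  | empty => simp
  | insert i S hi ih =>
    rw [Finset.prod_insert hi, Finset.prod_insert hi, Finset.card_insert_of_notMem hi,
      Nat.add_sub_cancel]
    have hD : 0 ≤ D := (norm_nonneg _).trans (hab i)
    have hpa : ‖∏ i ∈ S, a i‖ ≤ B ^ S.card := by
      rw [norm_prod]
      exact (Finset.prod_le_prod (fun _ _ => norm_nonneg _) fun j _ => ha j).trans_eq
        (Finset.prod_const B)
    have e : a i * ∏ i ∈ S, a i - b i * ∏ i ∈ S, b i
        = (a i - b i) * ∏ i ∈ S, a i + b i * (∏ i ∈ S, a i - ∏ i ∈ S, b i) := by ring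
    have hcard : B * (S.card * D * B ^ (S.card - 1)) = S.card * D * B ^ S.card := by
      rcases Nat.eq_zero_or_pos S.card with h | h
      · simp [h]
      · rw [mul_left_comm, ← pow_succ', Nat.sub_add_cancel h]
    calc _ ≤ D * B ^ S.card + B * (S.card * D * B ^ (S.card - 1)) := by
          rw [e]
          refine (norm_add_le _ _).trans (add_le_add ?_ ?_)
          · rw [norm_mul]
            exact mul_le_mul (hab i) hpa (norm_nonneg _) hD
          · rw [norm_mul]
            exact mul_le_mul (hb i) ih (norm_nonneg _) hB
      _ = _ := by rw [hcard]; push_cast; ring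

lemma exists_norm_prod_fW_sub_le {k s : ℕ} (hk : 1 ≤ k) (hs : 2 * k < s) {C : ℝ} (hC : 1 ≤ C) :
    ∃ c : ℝ, 0 ≤ c ∧ ∀ P : ℝ, 1 ≤ P → ∀ α : ℝ, |P ^ k * α| ≤ P ^ (1 / 3 : ℝ) →
      ∀ l : Fin s → ℝ, (∀ j, 1 / C ≤ |l j| ∧ |l j| ≤ C) →
        ‖∏ j, fW k P (l j * α) - P ^ s * ∏ j, v1 k (l j * (P ^ k * α))‖ ≤ c * P ^ (s - 1) := by
  set c₀ : ℝ := 3 + 4 * Real.pi * k * C with hc₀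
  set c₁ : ℝ := 8 * C + 8 * c₀ with hc₁
  have hπ := Real.pi_pos
  have hc₀0 : 0 < c₀ := by positivity
  refine ⟨s * c₀ * c₁ ^ (s - 1), by positivity, fun P hP α hα l hl => ?_⟩
  have hP0 : 0 < P := by linarith
  have hk0 : (0 : ℝ) < k := by exact_mod_cast hk
  have hk1 : (1 / k : ℝ) ≤ 1 := by
    rw [div_le_one hk0]; exact_mod_cast hk
  set X : ℝ := 1 + |P ^ k * α| with hX
  have hX1 : 1 ≤ X := by linarith [abs_nonneg (P ^ k * α)]
  have hX0 : 0 < X := by linarith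
  have hX3 : X ^ 3 ≤ 8 * P := by
    have h1 : (1 : ℝ) ≤ P ^ (1 / 3 : ℝ) := Real.one_le_rpow hP (by norm_num)
    calc X ^ 3 ≤ (2 * P ^ (1 / 3 : ℝ)) ^ 3 := by gcongr; linarith
      _ = 8 * P := by
        rw [mul_pow, ← Real.rpow_natCast (P ^ (1 / 3 : ℝ)), ← Real.rpow_mul hP0.le]
        norm_num
  set Y : ℝ := X ^ (-(1 / k : ℝ)) with hY
  have hY0 : 0 < Y := Real.rpow_pos_of_pos hX0 _
  have hY1 : Y ≤ 1 := Real.rpow_le_one_of_one_le_of_nonpos hX1 (neg_nonpos.2 (by positivity))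
  have hYk : Y ^ k = X⁻¹ := by
    rw [hY, ← Real.rpow_natCast, ← Real.rpow_mul hX0.le, neg_mul, one_div,
      inv_mul_cancel₀ hk0.ne', Real.rpow_neg_one]
  have hXY : X ≤ 8 * P * Y := by
    have h1 : X⁻¹ ≤ Y := by
      rw [← Real.rpow_neg_one]
      exact Real.rpow_le_rpow_of_exponent_le hX1 (by linarith)
    have h2 : X ^ 2 ≤ X ^ 3 := pow_le_pow_right₀ hX1 (by norm_num)
    calc X = X ^ 2 * X⁻¹ := by field_simp
      _ ≤ 8 * P * Y := mul_le_mul (h2.trans hX3) h1 (by positivity) (by positivity)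
  have hb : ∀ j, ‖(P : ℂ) * v1 k (l j * (P ^ k * α))‖ ≤ 8 * C * P * Y := fun j => by
    rw [norm_mul, Complex.norm_real, Real.norm_of_nonneg hP0.le]
    have := mul_le_mul_of_nonneg_left (norm_v1_mul_le hk hC (hl j).1 (P ^ k * α)) hP0.le
    linarith
  have hab : ∀ j, ‖fW k P (l j * α) - (P : ℂ) * v1 k (l j * (P ^ k * α))‖ ≤ c₀ * X := fun j => by
    have h := norm_fW_sub_le k hk hP0 (l j * α)
    rw [show l j * α * P ^ k = l j * (P ^ k * α) by ring] at h
    refine h.trans ?_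
    have h2 : |l j * α| * P ^ k ≤ C * (X - 1) := by
      rw [hX, add_sub_cancel_left, abs_mul, abs_mul, abs_of_pos (pow_pos hP0 k), mul_assoc,
        mul_comm |α|]
      exact mul_le_mul_of_nonneg_right (hl j).2 (by positivity)
    calc 3 + 4 * Real.pi * k * (|l j * α| * P ^ k)
        ≤ 3 * X + 4 * Real.pi * k * (C * X) := by
          refine add_le_add (by linarith) (mul_le_mul_of_nonneg_left ?_ (by positivity))
          exact h2.trans (by nlinarith)
      _ = c₀ * X := by rw [hc₀]; ring
  have ha : ∀ j, ‖fW k P (l j * α)‖ ≤ c₁ * P * Y := fun j => by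
    have h1 := norm_le_norm_add_norm_sub' (fW k P (l j * α)) (P * v1 k (l j * (P ^ k * α)))
    have h2 := hb j
    have h3 := hab j
    have h4 : c₀ * X ≤ c₀ * (8 * P * Y) := by gcongr
    rw [hc₁]
    linarith
  have hb' : ∀ j, ‖(P : ℂ) * v1 k (l j * (P ^ k * α))‖ ≤ c₁ * P * Y := fun j =>
    (hb j).trans (by rw [hc₁]; gcongr; linarith)
  have h := norm_prod_sub_prod_le Finset.univ (by positivity) ha hb' hab
  rw [Finset.prod_mul_distrib, Finset.prod_const, Finset.card_univ, Fintype.card_fin] at h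
  refine h.trans ?_
  have hYs : Y ^ (s - 1) ≤ X⁻¹ := by
    rw [← hYk]
    exact pow_le_pow_of_le_one hY0.le hY1 (by omega)
  calc s * (c₀ * X) * (c₁ * P * Y) ^ (s - 1)
      = s * c₀ * c₁ ^ (s - 1) * P ^ (s - 1) * (X * Y ^ (s - 1)) := by
        rw [mul_pow, mul_pow]; ring
    _ ≤ s * c₀ * c₁ ^ (s - 1) * P ^ (s - 1) * (X * X⁻¹) := by gcongr
    _ = _ := by rw [mul_inv_cancel₀ hX0.ne', mul_one]

/-! ### The weight -/

lemma abs_sinc_sub_one_le (x : ℝ) : |Real.sinc x - 1| ≤ 2 * |x| := by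
  wlog hx : 0 ≤ x generalizing x
  · have := this (-x) (by linarith)
    rwa [Real.sinc_neg, abs_neg] at this
  rcases hx.eq_or_lt with rfl | hx0
  · simp
  rw [abs_of_nonneg hx, abs_le]
  refine ⟨?_, by linarith [Real.sinc_le_one x]⟩
  rcases le_total x 1 with h | h
  · have h1 := Real.sin_gt_sub_cube hx0
    have h2 : 1 - x ^ 2 / 6 ≤ Real.sinc x := by
      rw [Real.sinc_of_ne_zero hx0.ne', le_div_iff₀ hx0]
      linarith
    nlinarith
  · linarith [Real.neg_one_le_sinc x]

/-- The density of `d_η` in its continuous version. -/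
noncomputable def weight (η α : ℝ) : ℝ := η * Real.sinc (Real.pi * η * α) ^ 2

@[fun_prop] lemma continuous_weight (η : ℝ) : Continuous (weight η) := by
  unfold weight
  have := Real.continuous_sinc
  fun_prop

lemma abs_weight_le {η : ℝ} (hη : 0 ≤ η) (α : ℝ) : |weight η α| ≤ η := by
  rw [weight, abs_mul, abs_of_nonneg hη, abs_pow]
  exact mul_le_of_le_one_right hη (pow_le_one₀ (abs_nonneg _) (Real.abs_sinc_le_one _))

lemma abs_weight_sub_le {η : ℝ} (hη : 0 ≤ η) (α : ℝ) :
    |weight η α - η| ≤ 4 * Real.pi * η ^ 2 * |α| := by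
  set y := Real.sinc (Real.pi * η * α) with hy
  have h1 : |y - 1| ≤ 2 * (Real.pi * η * |α|) := by
    refine (abs_sinc_sub_one_le _).trans_eq ?_
    rw [abs_mul, abs_of_nonneg (mul_nonneg Real.pi_pos.le hη)]
  have h2 : |y + 1| ≤ 2 := by
    refine (abs_add_le _ _).trans ?_
    rw [abs_one]
    linarith [Real.abs_sinc_le_one (Real.pi * η * α)]
  have e : weight η α - η = η * ((y + 1) * (y - 1)) := by rw [weight, ← hy]; ring
  rw [e, abs_mul, abs_mul, abs_of_nonneg hη]
  calc η * (|y + 1| * |y - 1|) ≤ η * (2 * (2 * (Real.pi * η * |α|))) := by gcongr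
    _ = _ := by ring

lemma setIntegral_dEta {η : ℝ} (hη : 0 ≤ η) {S : Set ℝ} (hS : MeasurableSet S) (g : ℝ → ℂ) :
    ∫ α in S, g α ∂dEta η = ∫ α in S, (weight η α : ℂ) * g α := by
  rw [dEta, setIntegral_withDensity_eq_setIntegral_toReal_smul (by fun_prop)
    (ae_of_all _ fun _ => ENNReal.ofReal_lt_top) _ hS]
  have h0 : ∀ᵐ α : ℝ ∂volume.restrict S, α ≠ 0 :=
    ae_restrict_of_ae (compl_mem_ae_iff.2 (measure_singleton 0))
  refine integral_congr_ae ?_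
  filter_upwards [h0] with α hα
  rw [ENNReal.toReal_ofReal (by positivity), Complex.real_smul, weight]
  rcases hη.eq_or_lt with rfl | hη
  · simp
  · rw [Real.sinc_of_ne_zero (by have := Real.pi_pos; positivity)]

/-! ### The main term and the tail -/

lemma norm_setIntegral_tail_le {k s : ℕ} (hk : 1 ≤ k) (hs : 2 * k < s) {C : ℝ} (hC : 1 ≤ C)
    {l : Fin s → ℝ} (hl : ∀ j, 1 / C ≤ |l j|) {T R : ℝ} (hT : 0 < T) (hR : 0 < R) :
    ‖∫ α in (Icc (-(R / T)) (R / T))ᶜ, ∏ j, v1 k (l j * (T * α))‖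
      ≤ (8 * C) ^ s * R⁻¹ * (T⁻¹ * ∫ β : ℝ, (1 + ‖β‖) ^ (-(1 + 1 / k : ℝ))) := by
  set W : ℝ → ℝ := fun β => (1 + ‖β‖) ^ (-(1 + 1 / k : ℝ)) with hW
  have hW0 : ∀ β, 0 ≤ W β := fun β => by positivity
  have hWint : Integrable fun α => W (T * α) :=
    (integrable_majorant hk).comp_mul_left' hT.ne'
  calc _ ≤ ∫ α in (Icc (-(R / T)) (R / T))ᶜ, (8 * C) ^ s * R⁻¹ * W (T * α) := by
        refine norm_integral_le_of_norm_le (hWint.const_mul _).integrableOn ?_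
        refine (ae_restrict_iff' measurableSet_Icc.compl).2 (ae_of_all _ fun α hα => ?_)
        have hα' : R / T < |α| := by
          rw [mem_compl_iff, mem_Icc, ← abs_le, not_le] at hα
          exact hα
        have hRα : R ≤ 1 + |T * α| := by
          rw [div_lt_iff₀ hT] at hα'
          rw [abs_mul, abs_of_pos hT]
          linarith
        refine (norm_prod_v1_le hk hs hC hl _).trans ?_
        rw [mul_assoc]
        refine mul_le_mul_of_nonneg_left ?_ (by positivity)
        exact mul_le_mul_of_nonneg_right (inv_anti₀ hR hRα) (hW0 _)
    _ ≤ ∫ α, (8 * C) ^ s * R⁻¹ * W (T * α) :=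
        setIntegral_le_integral (hWint.const_mul _)
          (ae_of_all _ fun α => mul_nonneg (by positivity) (hW0 _))
    _ = _ := by
        rw [integral_const_mul, Measure.integral_comp_mul_left W, abs_of_pos (inv_pos.2 hT),
          smul_eq_mul]

end CentralInterval

open CentralInterval in
/-- For k ≥ 2, s > 2k, C ≥ 2 there is a continuous positive function
J_{k,s} on Λ_k^{(s)} such that the central-interval contribution
∫_{|α| ≤ P^{1/3−k}} f(λ_1α)⋯f(λ_sα) d_ηα equals η J_{k,s}(λ) P^{s−k} + O(P^{s−k−1/3}),
uniformly for 0 < η ≤ 2 and λ ∈ Λ_k^{(s)}(C). -/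
theorem stmt11 (k s : ℕ) (hk : 2 ≤ k) (hs : 2 * k < s) (C : ℝ) (hC : 2 ≤ C) :
    ∃ J : (Fin s → ℝ) → ℝ, ContinuousOn J (Lam k s) ∧ (∀ l ∈ Lam k s, 0 < J l) ∧
      ∃ c : ℝ, 0 < c ∧ ∀ P : ℝ, 2 ≤ P → ∀ η : ℝ, 0 < η → η ≤ 2 → ∀ l ∈ LamC k s C,
        ‖(∫ α in Set.Icc (-(P ^ ((1 : ℝ) / 3 - k))) (P ^ ((1 : ℝ) / 3 - k)),
              ∏ j, fW k P (l j * α) ∂dEta η) -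
            ((η * J l * P ^ ((s : ℝ) - k) : ℝ) : ℂ)‖
          ≤ c * P ^ ((s : ℝ) - k - 1 / 3) := by
  have hk1 : 1 ≤ k := by omega
  have hC1 : 1 ≤ C := by linarith
  have hπ := Real.pi_pos
  refine ⟨fun l => (singularIntegral k s l).re, fun l hl => ?_,
    fun l hl => re_singularIntegral_pos hk1 hs hl, ?_⟩
  · exact (Complex.continuous_re.continuousAt.comp
      (continuousAt_singularIntegral hk1 hs hl.1)).continuousWithinAt
  obtain ⟨c₁, hc₁, hprod⟩ := exists_norm_prod_fW_sub_le hk1 hs hC1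
  set I₀ : ℝ := ∫ β : ℝ, (1 + ‖β‖) ^ (-(1 + 1 / k : ℝ)) with hI₀
  have hI₀0 : 0 ≤ I₀ := integral_nonneg fun β => by positivity
  set c₂ : ℝ := 2 * c₁ + 16 * Real.pi * 2 ^ s with hc₂
  have hc₂0 : 0 < c₂ := by positivity
  refine ⟨2 * c₂ + 2 * ((8 * C) ^ s * I₀), by positivity, fun P hP η hη hη2 l hl => ?_⟩
  have hP0 : 0 < P := by linarith
  have hP1 : 1 ≤ P := by linarith
  have hlC : ∀ j, 1 / C ≤ |l j| := fun j => (hl.2 j).1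
  set T : ℝ := P ^ k with hT
  have hT0 : 0 < T := pow_pos hP0 k
  set R : ℝ := P ^ (1 / 3 : ℝ) with hR
  have hR0 : 0 < R := Real.rpow_pos_of_pos hP0 _
  have hA : P ^ ((1 : ℝ) / 3 - k) = R / T := by
    rw [Real.rpow_sub hP0, Real.rpow_natCast]
  rw [hA]
  set S : Set ℝ := Set.Icc (-(R / T)) (R / T) with hS
  have hSm : MeasurableSet S := measurableSet_Icc
  set F : ℝ → ℂ := fun α => ∏ j, fW k P (l j * α) with hF
  set G : ℝ → ℂ := fun α => ∏ j, v1 k (l j * (T * α)) with hG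
  have hFc : Continuous F := by
    simp only [hF, fW]
    fun_prop
  have hGc : Continuous G := by fun_prop
  have hGint : Integrable G :=
    (integrable_prod_v1 hk1 hs hC1 hlC).comp_mul_left' hT0.ne'
  have hmain : ((singularIntegral k s l).re : ℂ) = T * ∫ α, G α := by
    rw [ofReal_re_singularIntegral, hG, Measure.integral_comp_mul_left
      (fun β : ℝ => ∏ j, v1 k (l j * β)) T, abs_of_pos (inv_pos.2 hT0), Complex.real_smul,
      ← mul_assoc, ← Complex.ofReal_mul, mul_inv_cancel₀ hT0.ne', Complex.ofReal_one, one_mul]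
    rfl
  have hPsk : P ^ ((s : ℝ) - k) = P ^ s / T := by
    rw [Real.rpow_sub hP0, Real.rpow_natCast, Real.rpow_natCast]
  have hsplit : (∫ α in S, F α ∂dEta η)
      - ((η * (singularIntegral k s l).re * P ^ ((s : ℝ) - k) : ℝ) : ℂ)
      = (∫ α in S, ((weight η α : ℂ) * F α - η * P ^ s * G α))
        - η * P ^ s * ∫ α in Sᶜ, G α := by
    have hT' : (T : ℂ) ≠ 0 := by exact_mod_cast hT0.ne'
    rw [setIntegral_dEta hη.le hSm, integral_sub, integral_const_mul, hPsk]
    · push_cast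
      rw [hmain, ← integral_add_compl hSm hGint]
      field_simp
      ring
    · exact Continuous.integrableOn_Icc (by fun_prop)
    · exact Continuous.integrableOn_Icc (by fun_prop)
  rw [hsplit]
  have hRT : R / T ≤ P⁻¹ := by
    rw [← hA, ← Real.rpow_neg_one]
    refine Real.rpow_le_rpow_of_exponent_le hP1 ?_
    have : (2 : ℝ) ≤ k := by exact_mod_cast hk
    linarith
  have hpoint : ∀ α ∈ S, ‖(weight η α : ℂ) * F α - η * P ^ s * G α‖ ≤ c₂ * P ^ (s - 1) := by
    intro α hα
    have hα' : |α| ≤ R / T := abs_le.2 hα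
    have hTα : |T * α| ≤ R := by
      rw [abs_mul, abs_of_pos hT0, mul_comm]
      exact (le_div_iff₀ hT0).1 hα'
    have h1 := hprod P hP1 α hTα l hl.2
    have h2 : ‖G α‖ ≤ 2 ^ s := by
      rw [hG, norm_prod]
      refine (Finset.prod_le_prod (fun _ _ => norm_nonneg _)
        fun j _ => norm_v1_le_two k _).trans_eq ?_
      simp
    have e : (weight η α : ℂ) * F α - η * P ^ s * G α
        = weight η α * (F α - P ^ s * G α) + ((weight η α - η : ℝ) : ℂ) * (P ^ s * G α) := by
      push_cast
      ring
    have h3 : |weight η α - η| ≤ 16 * Real.pi * P⁻¹ := by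
      refine (abs_weight_sub_le hη.le α).trans ?_
      calc 4 * Real.pi * η ^ 2 * |α| ≤ 4 * Real.pi * 2 ^ 2 * P⁻¹ := by
            gcongr
            exact hα'.trans hRT
        _ = _ := by ring
    have hPs : P⁻¹ * P ^ s = P ^ (s - 1) := by
      obtain ⟨n, rfl⟩ : ∃ n, s = n + 1 := ⟨s - 1, by omega⟩
      rw [pow_succ, Nat.add_sub_cancel]
      field_simp
    rw [e]
    calc _ ≤ 2 * (c₁ * P ^ (s - 1)) + 16 * Real.pi * P⁻¹ * (P ^ s * 2 ^ s) := by
          refine (norm_add_le _ _).trans (add_le_add ?_ ?_)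
          · rw [norm_mul, Complex.norm_real]
            exact mul_le_mul ((abs_weight_le hη.le α).trans hη2) h1 (norm_nonneg _) zero_le_two
          · rw [norm_mul, norm_mul, norm_pow, Complex.norm_real, Complex.norm_real,
              Real.norm_of_nonneg hP0.le]
            exact mul_le_mul h3 (by gcongr) (by positivity) (by positivity)
      _ = 2 * (c₁ * P ^ (s - 1)) + 16 * Real.pi * 2 ^ s * (P⁻¹ * P ^ s) := by ring
      _ = c₂ * P ^ (s - 1) := by rw [hPs, hc₂]; ring
  have hcentral := norm_setIntegral_le_of_norm_le_const (μ := volume) (s := S)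
    (by simp [hS]) hpoint
  rw [hS, Real.volume_real_Icc_of_le (by have := div_pos hR0 hT0; linarith), ← hS] at hcentral
  have htail := norm_setIntegral_tail_le hk1 hs hC1 hlC hT0 hR0
  have hE1 : P ^ (s - 1) * (R / T) ≤ P ^ ((s : ℝ) - k - 1 / 3) := by
    rw [← hA, ← Real.rpow_natCast, ← Real.rpow_add hP0, Nat.cast_sub (by omega)]
    refine Real.rpow_le_rpow_of_exponent_le hP1 ?_
    push_cast
    linarith
  have hE2 : P ^ s * (R⁻¹ * T⁻¹) = P ^ ((s : ℝ) - k - 1 / 3) := by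
    rw [Real.rpow_sub hP0, hPsk, ← hR]
    field_simp
  calc _ ≤ c₂ * P ^ (s - 1) * (R / T - -(R / T))
        + 2 * P ^ s * ((8 * C) ^ s * R⁻¹ * (T⁻¹ * I₀)) := by
        refine (norm_sub_le _ _).trans (add_le_add hcentral ?_)
        rw [norm_mul, norm_mul, norm_pow, Complex.norm_real, Complex.norm_real,
          Real.norm_of_nonneg hP0.le, Real.norm_of_nonneg hη.le]
        exact mul_le_mul (by gcongr) htail (norm_nonneg _) (by positivity)
    _ = 2 * c₂ * (P ^ (s - 1) * (R / T)) + 2 * ((8 * C) ^ s * I₀) * (P ^ s * (R⁻¹ * T⁻¹)) := by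
        ring
    _ ≤ 2 * c₂ * P ^ ((s : ℝ) - k - 1 / 3)
        + 2 * ((8 * C) ^ s * I₀) * P ^ ((s : ℝ) - k - 1 / 3) := by
        rw [hE2]
        gcongr
    _ = _ := by ring
end

section
/- Let k ≥ 2, C ≥ 2, and P ≥ 2. For f(α) = Σ_{|x| ≤ P} e(α x^k), one has ∫_{−C}^{C} |f(λα)| dλ ≪ P^{1/2} uniformly for all real α with |α| ≥ 1, with an implicit constant depending only on C (and k). Consequently, uniformly in 0 < η ≤ 2, ∫_{Λ_k^{(s)}(C)} ∫_{|α| ≥ 1} |f(λ_1 α) ⋯ f(λ_s α)| d_η α dλ ≪ P^{s/2}. -/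
open MeasureTheory

theorem continuous_fW (k : ℕ) (P : ℝ) : Continuous (fW k P) := by
  unfold fW eF
  fun_prop

theorem conj_eF (t : ℝ) : (starRingEnd ℂ) (eF t) = eF (-t) := by
  simp [eF, ← Complex.exp_conj, Complex.conj_ofNat]

theorem eF_add (s t : ℝ) : eF (s + t) = eF s * eF t := by
  simp only [eF, ← Complex.exp_add]
  push_cast
  ring_nf

theorem norm_fW_neg (k : ℕ) (P α : ℝ) : ‖fW k P (-α)‖ = ‖fW k P α‖ := by
  have h : fW k P (-α) = (starRingEnd ℂ) (fW k P α) := by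
    simp [fW, map_sum, conj_eF]
  rw [h, RCLike.norm_conj]

/-- The square of the Weyl sum as a double sum. -/
theorem norm_sq_fW (k : ℕ) (P α : ℝ) :
    ((‖fW k P α‖ ^ 2 : ℝ) : ℂ) =
      ∑ x ∈ Finset.Icc (-(⌊P⌋ : ℤ)) ⌊P⌋, ∑ y ∈ Finset.Icc (-(⌊P⌋ : ℤ)) ⌊P⌋,
        eF (((x ^ k - y ^ k : ℤ) : ℝ) * α) := by
  rw [Complex.ofReal_pow, ← Complex.mul_conj']
  simp only [fW, map_sum, Finset.sum_mul_sum, conj_eF, ← eF_add]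
  refine Finset.sum_congr rfl fun x _ => Finset.sum_congr rfl fun y _ => ?_
  congr 1
  push_cast
  ring

theorem integral_eF_int_mul (m : ℤ) (N : ℕ) :
    ∫ t in (-(N : ℝ))..N, eF ((m : ℝ) * t) = if m = 0 then (2 * N : ℂ) else 0 := by
  split_ifs with hm
  · simp [hm, eF]
    ring
  · have hc : 2 * (Real.pi : ℂ) * Complex.I * m ≠ 0 := by
      simp [Real.pi_ne_zero, Complex.I_ne_zero, hm]
    have h := integral_exp_mul_complex (a := -(N : ℝ)) (b := N) hc
    have h1 : ∀ n : ℤ, Complex.exp (2 * (Real.pi : ℂ) * Complex.I * m * n) = 1 := by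
      intro n
      rw [← Complex.exp_int_mul_two_pi_mul_I (m * n)]
      push_cast
      ring_nf
    have h2 := h1 N
    have h3 := h1 (-N)
    push_cast at h2 h3 h
    rw [h2, h3, sub_self, zero_div] at h
    rw [← h]
    refine intervalIntegral.integral_congr fun t _ => ?_
    simp only [eF]
    push_cast
    ring_nf

theorem card_filter_pow_eq_le (k : ℕ) (hk : k ≠ 0) (s : Finset ℤ) (x : ℤ) :
    (s.filter fun y => x ^ k - y ^ k = 0).card ≤ 2 := by
  refine (Finset.card_le_card (t := {x, -x}) ?_).trans Finset.card_le_two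
  intro y hy
  have h : x ^ k = y ^ k := sub_eq_zero.1 (Finset.mem_filter.1 hy).2
  have h' : x.natAbs = y.natAbs := by
    refine Nat.pow_left_injective hk ?_
    simp only [← Int.natAbs_pow, h]
  simp only [Finset.mem_insert, Finset.mem_singleton]
  omega

theorem integral_norm_sq_fW_le (k : ℕ) (hk : k ≠ 0) (P : ℝ) (hP : 2 ≤ P) (N : ℕ) :
    ∫ t in (-(N : ℝ))..N, ‖fW k P t‖ ^ 2 ≤ 10 * P * N := by
  set S := Finset.Icc (-(⌊P⌋ : ℤ)) ⌊P⌋ with hS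
  have hcont : ∀ m : ℤ, Continuous fun t : ℝ => eF ((m : ℝ) * t) := fun m => by
    unfold eF
    fun_prop
  have h1 : ((∫ t in (-(N : ℝ))..N, ‖fW k P t‖ ^ 2 : ℝ) : ℂ) =
      ∑ x ∈ S, ∑ y ∈ S, if x ^ k - y ^ k = 0 then (2 * N : ℂ) else 0 := by
    rw [← intervalIntegral.integral_ofReal]
    simp only [norm_sq_fW]
    rw [intervalIntegral.integral_finsetSum fun x _ =>
      (continuous_finsetSum _ fun y _ => hcont _).intervalIntegrable _ _]
    refine Finset.sum_congr rfl fun x _ => ?_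
    rw [intervalIntegral.integral_finsetSum fun y _ => (hcont _).intervalIntegrable _ _]
    exact Finset.sum_congr rfl fun y _ => integral_eF_int_mul _ _
  have h2 : (∫ t in (-(N : ℝ))..N, ‖fW k P t‖ ^ 2) =
      ∑ x ∈ S, ((S.filter fun y => x ^ k - y ^ k = 0).card : ℝ) * (2 * N) := by
    have : ((∫ t in (-(N : ℝ))..N, ‖fW k P t‖ ^ 2 : ℝ) : ℂ) =
      ((∑ x ∈ S, ((S.filter fun y => x ^ k - y ^ k = 0).card : ℝ) * (2 * N) : ℝ) : ℂ) := by
      rw [h1]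
      push_cast
      refine Finset.sum_congr rfl fun x _ => ?_
      rw [← Finset.sum_filter, Finset.sum_const, nsmul_eq_mul]
    exact_mod_cast this
  have hcard : (S.card : ℝ) ≤ 5 / 2 * P := by
    have h0 : (0 : ℤ) ≤ ⌊P⌋ := Int.floor_nonneg.2 (by linarith)
    have h3 : (S.card : ℤ) = 2 * ⌊P⌋ + 1 := by
      rw [hS, Int.card_Icc, Int.toNat_of_nonneg (by omega)]
      ring
    have h4 : (S.card : ℝ) = 2 * ⌊P⌋ + 1 := by exact_mod_cast h3
    have := Int.floor_le P
    linarith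
  rw [h2]
  calc ∑ x ∈ S, ((S.filter fun y => x ^ k - y ^ k = 0).card : ℝ) * (2 * N)
      ≤ ∑ x ∈ S, (2 : ℝ) * (2 * N) := by
        refine Finset.sum_le_sum fun x _ => ?_
        gcongr
        exact_mod_cast card_filter_pow_eq_le k hk S x
    _ = S.card * (4 * N) := by
        rw [Finset.sum_const, nsmul_eq_mul]
        ring
    _ ≤ 5 / 2 * P * (4 * N) := by gcongr
    _ = 10 * P * N := by ring

theorem integral_norm_sq_fW_mul_le (k : ℕ) (hk : k ≠ 0) (C P α : ℝ) (hC : 0 ≤ C) (hP : 2 ≤ P)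
    (hα : 1 ≤ |α|) :
    ∫ l in (-C)..C, ‖fW k P (l * α)‖ ^ 2 ≤ 10 * (C + 1) * P := by
  have hpos : 0 < |α| := by linarith
  have h0 : (∫ l in (-C)..C, ‖fW k P (l * α)‖ ^ 2) = ∫ l in (-C)..C, ‖fW k P (l * |α|)‖ ^ 2 := by
    refine intervalIntegral.integral_congr fun l _ => ?_
    rcases abs_choice α with h | h
    · simp only [h]
    · simp only [h, mul_neg, norm_fW_neg]
  have hN : (⌈C * |α|⌉₊ : ℝ) ≤ (C + 1) * |α| := by
    have := (Nat.ceil_lt_add_one (mul_nonneg hC hpos.le)).le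
    linarith
  have hle : C * |α| ≤ ⌈C * |α|⌉₊ := Nat.le_ceil _
  have hm : (∫ t in (-C * |α|)..(C * |α|), ‖fW k P t‖ ^ 2) ≤
      ∫ t in (-(⌈C * |α|⌉₊ : ℝ))..⌈C * |α|⌉₊, ‖fW k P t‖ ^ 2 := by
    refine intervalIntegral.integral_mono_interval (by linarith) ?_ hle ?_ ?_
    · have := mul_nonneg hC hpos.le
      linarith
    · exact Filter.Eventually.of_forall fun t => by positivity
    · exact ((continuous_fW k P).norm.pow 2).intervalIntegrable _ _
  rw [h0, intervalIntegral.integral_comp_mul_right (fun t => ‖fW k P t‖ ^ 2) hpos.ne', smul_eq_mul,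
    inv_mul_le_iff₀ hpos]
  calc _ ≤ _ := hm
    _ ≤ 10 * P * ⌈C * |α|⌉₊ := integral_norm_sq_fW_le k hk P hP _
    _ ≤ 10 * P * ((C + 1) * |α|) := by gcongr
    _ = _ := by ring

theorem setIntegral_norm_fW_mul_le (k : ℕ) (hk : k ≠ 0) (C P α : ℝ) (hC : 0 ≤ C) (hP : 2 ≤ P)
    (hα : 1 ≤ |α|) :
    ∫ l in Set.Icc (-C) C, ‖fW k P (l * α)‖ ≤ (6 * C + 5) * P ^ ((1 : ℝ) / 2) := by
  rw [integral_Icc_eq_integral_Ioc, ← intervalIntegral.integral_of_le (by linarith),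
    ← Real.sqrt_eq_rpow]
  have hr : 0 < √P := Real.sqrt_pos.2 (by linarith)
  have hrr : √P ^ 2 = P := Real.sq_sqrt (by linarith)
  have hc : Continuous fun l : ℝ => fW k P (l * α) :=
    (continuous_fW k P).comp (by fun_prop)
  calc ∫ l in (-C)..C, ‖fW k P (l * α)‖
      ≤ ∫ l in (-C)..C, (√P / 2 + (2 * √P)⁻¹ * ‖fW k P (l * α)‖ ^ 2) := by
        refine intervalIntegral.integral_mono_on (by linarith)
          (hc.norm.intervalIntegrable _ _)
          (Continuous.intervalIntegrable (by fun_prop) _ _) fun l _ => ?_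
        rw [← sub_nonneg]
        have : √P / 2 + (2 * √P)⁻¹ * ‖fW k P (l * α)‖ ^ 2 - ‖fW k P (l * α)‖ =
            (2 * √P)⁻¹ * (√P - ‖fW k P (l * α)‖) ^ 2 := by
          field_simp
          ring
        rw [this]
        positivity
    _ = C * √P + (2 * √P)⁻¹ * ∫ l in (-C)..C, ‖fW k P (l * α)‖ ^ 2 := by
        rw [intervalIntegral.integral_add (by simp)
          (Continuous.intervalIntegrable (by fun_prop) _ _),
          intervalIntegral.integral_const_mul, intervalIntegral.integral_const, smul_eq_mul]
        ring
    _ ≤ C * √P + (2 * √P)⁻¹ * (10 * (C + 1) * P) := by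
        gcongr
        exact integral_norm_sq_fW_mul_le k hk C P α hC hP hα
    _ = (6 * C + 5) * √P := by
        nth_rewrite 3 [← hrr]
        field_simp
        ring

theorem sin_div_sq_le (x : ℝ) : (Real.sin x / x) ^ 2 ≤ 2 * (1 + x ^ 2)⁻¹ := by
  rcases eq_or_ne x 0 with rfl | hx
  · simp
  · rw [div_pow, ← div_eq_mul_inv, div_le_div_iff₀ (by positivity) (by positivity)]
    nlinarith [Real.sin_sq_le_sq (x := x), mul_le_mul_of_nonneg_right (Real.sin_sq_le_one x)
      (sq_nonneg x)]

/-- The total mass of `dEta η` is bounded uniformly in `η`. -/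
theorem dEta_univ_le (η : ℝ) (hη : 0 < η) : dEta η Set.univ ≤ ENNReal.ofReal 2 := by
  have hp : 0 < Real.pi * η := by positivity
  rw [dEta, withDensity_apply _ MeasurableSet.univ, Measure.restrict_univ]
  calc _ ≤ ∫⁻ α : ℝ, ENNReal.ofReal (2 * η * (1 + (Real.pi * η * α) ^ 2)⁻¹) := by
        refine lintegral_mono fun α => ENNReal.ofReal_le_ofReal ?_
        have := mul_le_mul_of_nonneg_left (sin_div_sq_le (Real.pi * η * α)) hη.le
        linarith
    _ = ENNReal.ofReal (∫ α : ℝ, 2 * η * (1 + (Real.pi * η * α) ^ 2)⁻¹) := by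
        rw [ofReal_integral_eq_lintegral_ofReal]
        · exact (integrable_inv_one_add_sq.comp_mul_left' hp.ne').const_mul _
        · exact Filter.Eventually.of_forall fun α => by positivity
    _ = ENNReal.ofReal 2 := by
        congr 1
        rw [integral_const_mul, Measure.integral_comp_mul_left (fun y : ℝ => (1 + y ^ 2)⁻¹),
          integral_univ_inv_one_add_sq, smul_eq_mul, abs_of_pos (by positivity)]
        field_simp

theorem lintegral_box_prod_fW_le (k s : ℕ) (hk : k ≠ 0) (C P α : ℝ) (hC : 0 ≤ C) (hP : 2 ≤ P)
    (hα : 1 ≤ |α|) :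
    ∫⁻ l in Set.univ.pi fun _ : Fin s => Set.Icc (-C) C, ‖∏ j, fW k P (l j * α)‖ₑ ≤
      ENNReal.ofReal ((6 * C + 5) ^ s * P ^ ((s : ℝ) / 2)) := by
  have hc : Continuous fun l : ℝ => fW k P (l * α) :=
    (continuous_fW k P).comp (by fun_prop)
  have hi : Integrable (fun l : ℝ => fW k P (l * α)) (volume.restrict (Set.Icc (-C) C)) :=
    hc.continuousOn.integrableOn_Icc
  rw [volume_pi, Measure.restrict_pi_pi, ← ofReal_integral_norm_eq_lintegral_enorm
    (Integrable.fintype_prod (f := fun _ : Fin s => fun l : ℝ => fW k P (l * α)) fun _ => hi)]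
  refine ENNReal.ofReal_le_ofReal ?_
  simp only [norm_prod]
  rw [integral_fintype_prod_eq_prod (fun _ : Fin s => fun l : ℝ => ‖fW k P (l * α)‖),
    Finset.prod_const, Finset.card_univ, Fintype.card_fin]
  have hP' : P ^ ((s : ℝ) / 2) = (P ^ ((1 : ℝ) / 2)) ^ s := by
    rw [← Real.rpow_natCast, ← Real.rpow_mul (by linarith)]
    ring_nf
  rw [hP', ← mul_pow]
  exact pow_le_pow_left₀ (integral_nonneg fun _ => norm_nonneg _)
    (setIntegral_norm_fW_mul_le k hk C P α hC hP hα) s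

/-- For k ≥ 2, C ≥ 2, P ≥ 2 one has ∫_{−C}^{C} |f(λα)| dλ ≪ P^{1/2}
uniformly for |α| ≥ 1; consequently, uniformly in 0 < η ≤ 2,
∫_{Λ_k^{(s)}(C)} ∫_{|α| ≥ 1} |f(λ_1α)⋯f(λ_sα)| d_ηα dλ ≪ P^{s/2}. -/
theorem stmt12 (k s : ℕ) (hk : 2 ≤ k) (hs : 1 ≤ s) (C : ℝ) (hC : 2 ≤ C) :
    ∃ c : ℝ, 0 < c ∧ ∀ P : ℝ, 2 ≤ P →
      (∀ α : ℝ, 1 ≤ |α| →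
        (∫ l in Set.Icc (-C) C, ‖fW k P (l * α)‖) ≤ c * P ^ ((1 : ℝ) / 2)) ∧
      (∀ η : ℝ, 0 < η → η ≤ 2 →
        (∫⁻ l in LamC k s C, ∫⁻ α in {α : ℝ | 1 ≤ |α|},
            (‖∏ j, fW k P (l j * α)‖₊ : ENNReal) ∂dEta η)
          ≤ ENNReal.ofReal (c * P ^ ((s : ℝ) / 2))) := by
  have hk0 : k ≠ 0 := by omega
  have hC0 : 0 ≤ C := by linarith
  refine ⟨6 * C + 5 + 2 * (6 * C + 5) ^ s, by positivity, fun P hP => ⟨fun α hα => ?_,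
    fun η hη _ => ?_⟩⟩
  · have hP0 : 0 ≤ P := by linarith
    refine (setIntegral_norm_fW_mul_le k hk0 C P α hC0 hP hα).trans ?_
    exact mul_le_mul_of_nonneg_right (le_add_of_nonneg_right (by positivity)) (by positivity)
  · have hP0 : 0 ≤ P := by linarith
    have : IsFiniteMeasure (dEta η) := ⟨(dEta_univ_le η hη).trans_lt ENNReal.ofReal_lt_top⟩
    have hsub : LamC k s C ⊆ Set.univ.pi fun _ => Set.Icc (-C) C :=
      fun l hl j _ => abs_le.1 (hl.2 j).2
    have hmeas : MeasurableSet {α : ℝ | 1 ≤ |α|} := measurableSet_le measurable_const (by fun_prop)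
    set B := ENNReal.ofReal ((6 * C + 5) ^ s * P ^ ((s : ℝ) / 2)) with hB
    calc _ ≤ ∫⁻ l in Set.univ.pi fun _ : Fin s => Set.Icc (-C) C, ∫⁻ α in {α : ℝ | 1 ≤ |α|},
            ‖∏ j, fW k P (l j * α)‖ₑ ∂dEta η := lintegral_mono_set hsub
      _ = ∫⁻ α in {α : ℝ | 1 ≤ |α|}, ∫⁻ l in Set.univ.pi fun _ : Fin s => Set.Icc (-C) C,
            ‖∏ j, fW k P (l j * α)‖ₑ ∂volume ∂dEta η := by
          refine lintegral_lintegral_swap (Continuous.aemeasurable ?_)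
          have := continuous_fW k P
          simp only [Function.uncurry_def]
          fun_prop
      _ ≤ ∫⁻ α in {α : ℝ | 1 ≤ |α|}, B ∂dEta η :=
          setLIntegral_mono' hmeas fun α hα => lintegral_box_prod_fW_le k s hk0 C P α hC0 hP hα
      _ ≤ B * ENNReal.ofReal 2 := by
          rw [setLIntegral_const]
          gcongr
          exact (measure_mono (Set.subset_univ _)).trans (dEta_univ_le η hη)
      _ ≤ _ := by
          rw [hB, ← ENNReal.ofReal_mul (by positivity)]
          refine ENNReal.ofReal_le_ofReal ?_
          have : 0 ≤ (6 * C + 5) * P ^ ((s : ℝ) / 2) := by positivity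
          linarith
end
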